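/- arXiv:2301.06783 — 3 statements merged into one kernel-verified Lean document; each statement's English description precedes it below -/
import Mathlib

section
/- Let ρ and σ be N×N positive semidefinite complex matrices of trace 1 (density matrices), let r₁, r₂ be natural numbers and δ, ε₁, ε₂ ≥ 0. If ρ is (r₁, δ, ε₁)-approximately-low-rank and σ is (r₂, δ, ε₂)-approximately-low-rank, then (ρ − σ)/2 is (r₁ + r₂, δ/2, ((r₁ + r₂)δ + ε₁ + ε₂)/2)-approximately-low-rank. -/
open Finset ComplexOrder

/-- The approximate rank of a Hermitian matrix with respect to `δ`:
the number of eigenvalues (with multiplicity) of absolute value greater than `δ`. -/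
noncomputable def hermRank {N : ℕ} {A : Matrix (Fin N) (Fin N) ℂ}
    (hA : A.IsHermitian) (δ : ℝ) : ℕ :=
  (Finset.univ.filter (fun j => δ < |hA.eigenvalues j|)).card

/-- The sum of the absolute values of the eigenvalues of a Hermitian matrix
that are at most `δ` in absolute value. -/
noncomputable def hermW {N : ℕ} {A : Matrix (Fin N) (Fin N) ℂ}
    (hA : A.IsHermitian) (δ : ℝ) : ℝ :=
  ∑ j ∈ Finset.univ.filter (fun j => |hA.eigenvalues j| ≤ δ), |hA.eigenvalues j|

/-- A Hermitian matrix is `(r, δ, ε)`-approximately-low-rank if at most `r` of its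
eigenvalues exceed `δ` in absolute value and the remaining ones sum to at most `ε`
in absolute value. -/
def ApproxLowRank {N : ℕ} {A : Matrix (Fin N) (Fin N) ℂ}
    (hA : A.IsHermitian) (r : ℕ) (δ ε : ℝ) : Prop :=
  hermRank hA δ ≤ r ∧ hermW hA δ ≤ ε

/-- The quadratic form of a Hermitian matrix, expanded in an eigenbasis. -/
theorem Matrix.IsHermitian.re_inner_toEuclideanLin_eq_sum {n : Type*} [Fintype n] [DecidableEq n]
    {A : Matrix n n ℂ} (hA : A.IsHermitian) (x : EuclideanSpace ℂ n) :
    (inner ℂ x (A.toEuclideanLin x)).re =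
      ∑ i, hA.eigenvalues i * ‖inner ℂ (hA.eigenvectorBasis i) x‖ ^ 2 := by
  have hsymm : A.toEuclideanLin.IsSymmetric := Matrix.isSymmetric_toEuclideanLin_iff.mpr hA
  have heig (i : n) : A.toEuclideanLin (hA.eigenvectorBasis i) =
      (hA.eigenvalues i : ℂ) • hA.eigenvectorBasis i := by
    ext j
    simpa [Matrix.toLpLin_apply] using congrFun (hA.mulVec_eigenvectorBasis i) j
  rw [← hA.eigenvectorBasis.sum_inner_mul_inner, Complex.re_sum]
  refine Finset.sum_congr rfl fun i _ => ?_
  rw [← hsymm, heig, inner_smul_left, Complex.conj_ofReal, mul_left_comm, Complex.re_ofReal_mul,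
    ← inner_conj_symm x, ← Complex.normSq_eq_conj_mul_self, Complex.ofReal_re,
    Complex.normSq_eq_norm_sq]

/-- If one diagonal quadratic form is dominated by another, then every superlevel set of the
coefficients of the first is at most as large as that of the second. -/
theorem OrthonormalBasis.card_le_card_of_sum_le_sum {ι κ E : Type*} [Fintype ι] [Fintype κ]
    [NormedAddCommGroup E] [InnerProductSpace ℂ E]
    (u : OrthonormalBasis ι ℂ E) (v : OrthonormalBasis κ ℂ E) (a : ι → ℝ) (b : κ → ℝ)
    (h : ∀ x, ∑ i, a i * ‖inner ℂ (u i) x‖ ^ 2 ≤ ∑ j, b j * ‖inner ℂ (v j) x‖ ^ 2)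
    (m : ℝ) (s : Finset ι) (t : Finset κ) (hs : ∀ i ∈ s, m ≤ a i) (ht : ∀ j ∉ t, b j < m) :
    s.card ≤ t.card := by
  classical
  by_contra! hlt
  let f : (s → ℂ) →ₗ[ℂ] E := Fintype.linearCombination ℂ fun i : s => u i
  let g : E →ₗ[ℂ] (t → ℂ) := LinearMap.pi fun j : t => innerₛₗ ℂ (v j)
  have hker : LinearMap.ker (g ∘ₗ f) ≠ ⊥ := by
    apply LinearMap.ker_ne_bot_of_finrank_lt
    simpa using hlt
  obtain ⟨c, hc, hc0⟩ := (Submodule.ne_bot_iff _).mp hker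
  set x := f c with hx
  have hx_eq : x = ∑ i : s, c i • u i := by simp [hx, f, Fintype.linearCombination_apply]
  have hv (j : κ) (hj : j ∈ t) : inner ℂ (v j) x = 0 := congrFun hc ⟨j, hj⟩
  have hu (i : ι) (hi : i ∉ s) : inner ℂ (u i) x = 0 := by
    rw [hx_eq, inner_sum]
    refine Finset.sum_eq_zero fun k _ => ?_
    rw [inner_smul_right, u.inner_eq_ite, if_neg (by rintro rfl; exact hi k.2), mul_zero]
  have hx0 : x ≠ 0 := by
    have hli : LinearIndependent ℂ fun i : s => u i :=
      u.orthonormal.linearIndependent.comp _ Subtype.val_injective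
    intro h0
    exact hc0 (funext (Fintype.linearIndependent_iff.mp hli c (hx_eq.symm.trans h0)))
  have hlower : m * ‖x‖ ^ 2 ≤ ∑ i, a i * ‖inner ℂ (u i) x‖ ^ 2 := by
    rw [← u.sum_sq_norm_inner_right x, Finset.mul_sum]
    refine Finset.sum_le_sum fun i _ => ?_
    by_cases hi : i ∈ s
    · gcongr
      exact hs i hi
    · simp [hu i hi]
  have hupper : ∑ j, b j * ‖inner ℂ (v j) x‖ ^ 2 < m * ‖x‖ ^ 2 := by
    rw [← v.sum_sq_norm_inner_right x, Finset.mul_sum]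
    obtain ⟨j, hj⟩ : ∃ j, inner ℂ (v j) x ≠ 0 := by
      by_contra! h0
      apply hx0
      rw [← v.sum_repr' x]
      simp [h0]
    refine Finset.sum_lt_sum (fun k _ => ?_) ⟨j, Finset.mem_univ _, ?_⟩
    · by_cases hk : k ∈ t
      · simp [hv k hk]
      · have := (ht k hk).le
        gcongr
    · have := ht j fun hjt => hj (hv j hjt)
      gcongr
  exact absurd (h x) (not_le.mpr (hupper.trans_le hlower))

/-- Weyl monotonicity: if one diagonal quadratic form is dominated by another, the coefficients
of the first can be matched injectively with coefficients of the second that dominate them. -/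
theorem OrthonormalBasis.exists_injective_le_of_sum_le_sum {ι κ E : Type*} [Fintype ι] [Fintype κ]
    [NormedAddCommGroup E] [InnerProductSpace ℂ E]
    (u : OrthonormalBasis ι ℂ E) (v : OrthonormalBasis κ ℂ E) (a : ι → ℝ) (b : κ → ℝ)
    (h : ∀ x, ∑ i, a i * ‖inner ℂ (u i) x‖ ^ 2 ≤ ∑ j, b j * ‖inner ℂ (v j) x‖ ^ 2) :
    ∃ f : ι → κ, Function.Injective f ∧ ∀ i, a i ≤ b (f i) := by
  classical
  let t (i : ι) : Finset κ := Finset.univ.filter fun j => a i ≤ b j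
  have hall : ∀ s : Finset ι, s.card ≤ (s.biUnion t).card := by
    intro s
    obtain rfl | hne := s.eq_empty_or_nonempty
    · simp
    obtain ⟨i, hi, hmin⟩ := s.exists_min_image a hne
    refine (u.card_le_card_of_sum_le_sum v a b h (a i) s (t i) hmin fun j hj => ?_).trans
      (Finset.card_le_card (Finset.subset_biUnion_of_mem t hi))
    simpa [t] using hj
  obtain ⟨f, hf, hft⟩ := (Finset.all_card_le_biUnion_card_iff_exists_injective t).mp hall
  exact ⟨f, hf, fun i => by simpa [t] using hft i⟩

/-- Truncating the spectrum at `δ` and summing costs at most `δ` for each large eigenvalue. -/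
theorem sum_min_abs_eigenvalues_le {N : ℕ} {A : Matrix (Fin N) (Fin N) ℂ} (hA : A.IsHermitian)
    (δ : ℝ) : ∑ j, min |hA.eigenvalues j| δ ≤ hermRank hA δ * δ + hermW hA δ := by
  rw [← Finset.sum_filter_add_sum_filter_not Finset.univ (fun j => δ < |hA.eigenvalues j|)]
  simp only [hermRank, hermW, not_lt, ← nsmul_eq_mul]
  gcongr
  · exact Finset.sum_le_card_nsmul _ _ _ fun j _ => min_le_right _ _
  · exact min_le_left _ _

theorem approxLowRank_half_sub {N : ℕ} (ρ σ : Matrix (Fin N) (Fin N) ℂ)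
    (hρ : ρ.PosSemidef) (hσ : σ.PosSemidef)
    (hρtr : ρ.trace = 1) (hσtr : σ.trace = 1)
    (r₁ r₂ : ℕ) (δ ε₁ ε₂ : ℝ) (hδ : 0 ≤ δ) (hε₁ : 0 ≤ ε₁) (hε₂ : 0 ≤ ε₂)
    (hν : ((1 / 2 : ℂ) • (ρ - σ)).IsHermitian)
    (h₁ : ApproxLowRank hρ.isHermitian r₁ δ ε₁)
    (h₂ : ApproxLowRank hσ.isHermitian r₂ δ ε₂) :
    ApproxLowRank hν (r₁ + r₂) (δ / 2) (((r₁ + r₂ : ℝ) * δ + ε₁ + ε₂) / 2) := by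
  have hform (x : EuclideanSpace ℂ (Fin N)) :
      2 * (inner ℂ x (((1 / 2 : ℂ) • (ρ - σ)).toEuclideanLin x)).re =
        (inner ℂ x (ρ.toEuclideanLin x)).re - (inner ℂ x (σ.toEuclideanLin x)).re := by
    rw [map_smul, map_sub, LinearMap.smul_apply, LinearMap.sub_apply, inner_smul_right,
      inner_sub_right]
    simp
  simp only [Matrix.IsHermitian.re_inner_toEuclideanLin_eq_sum hν,
    Matrix.IsHermitian.re_inner_toEuclideanLin_eq_sum hρ.isHermitian,
    Matrix.IsHermitian.re_inner_toEuclideanLin_eq_sum hσ.isHermitian] at hform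
  have hp := hρ.eigenvalues_nonneg
  have hq := hσ.eigenvalues_nonneg
  obtain ⟨f, hf, hfle⟩ := hν.eigenvectorBasis.exists_injective_le_of_sum_le_sum
    hρ.isHermitian.eigenvectorBasis (fun i => 2 * hν.eigenvalues i) hρ.isHermitian.eigenvalues
    fun x => by
      have : 0 ≤ ∑ i, hσ.isHermitian.eigenvalues i *
          ‖inner ℂ (hσ.isHermitian.eigenvectorBasis i) x‖ ^ 2 :=
        Finset.sum_nonneg fun i _ => mul_nonneg (hq i) (sq_nonneg _)
      simp only [mul_assoc, ← Finset.mul_sum]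
      linarith [hform x]
  obtain ⟨g, hg, hgle⟩ := hν.eigenvectorBasis.exists_injective_le_of_sum_le_sum
    hσ.isHermitian.eigenvectorBasis (fun i => -2 * hν.eigenvalues i) hσ.isHermitian.eigenvalues
    fun x => by
      have : 0 ≤ ∑ i, hρ.isHermitian.eigenvalues i *
          ‖inner ℂ (hρ.isHermitian.eigenvectorBasis i) x‖ ^ 2 :=
        Finset.sum_nonneg fun i _ => mul_nonneg (hp i) (sq_nonneg _)
      simp only [mul_assoc, ← Finset.mul_sum]
      linarith [hform x]
  constructor
  · refine le_trans ?_ (add_le_add h₁.1 h₂.1)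
    have hsub : Finset.univ.filter (fun j => δ / 2 < |hν.eigenvalues j|) ⊆
        Finset.univ.filter (fun j => δ < |hρ.isHermitian.eigenvalues (f j)|) ∪
          Finset.univ.filter (fun j => δ < |hσ.isHermitian.eigenvalues (g j)|) := by
      intro j hj
      simp only [Finset.mem_union, Finset.mem_filter, Finset.mem_univ, true_and,
        abs_of_nonneg (hp _), abs_of_nonneg (hq _)] at hj ⊢
      rcases lt_abs.mp hj with h | h
      · exact Or.inl (by linarith [hfle j])
      · exact Or.inr (by linarith [hgle j])
    refine (Finset.card_le_card hsub).trans ((Finset.card_union_le _ _).trans (add_le_add ?_ ?_))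
    · exact Finset.card_le_card_of_injOn f (fun j hj => by simpa using hj) hf.injOn
    · exact Finset.card_le_card_of_injOn g (fun j hj => by simpa using hj) hg.injOn
  · have hpoint (j : Fin N) (hj : |hν.eigenvalues j| ≤ δ / 2) :
        |hν.eigenvalues j| ≤ (min |hρ.isHermitian.eigenvalues (f j)| δ +
          min |hσ.isHermitian.eigenvalues (g j)| δ) / 2 := by
      have h₃ : 0 ≤ min |hρ.isHermitian.eigenvalues (f j)| δ := le_min (abs_nonneg _) hδ
      have h₄ : 0 ≤ min |hσ.isHermitian.eigenvalues (g j)| δ := le_min (abs_nonneg _) hδ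
      obtain ⟨hl, hr⟩ := abs_le.mp hj
      have h₅ : 2 * hν.eigenvalues j ≤ min |hρ.isHermitian.eigenvalues (f j)| δ :=
        le_min ((hfle j).trans (le_abs_self _)) (by linarith)
      have h₆ : -2 * hν.eigenvalues j ≤ min |hσ.isHermitian.eigenvalues (g j)| δ :=
        le_min ((hgle j).trans (le_abs_self _)) (by linarith)
      exact abs_le.mpr ⟨by linarith, by linarith⟩
    have hsum : hermW hν (δ / 2) ≤ ∑ j, (min |hρ.isHermitian.eigenvalues (f j)| δ +
        min |hσ.isHermitian.eigenvalues (g j)| δ) / 2 :=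
      (Finset.sum_le_sum fun j hj => hpoint j (Finset.mem_filter.mp hj).2).trans
        (Finset.sum_le_univ_sum_of_nonneg fun j => by positivity)
    rw [← Finset.sum_div, Finset.sum_add_distrib,
      (Finite.injective_iff_bijective.mp hf).sum_comp
        (fun j => min |hρ.isHermitian.eigenvalues j| δ),
      (Finite.injective_iff_bijective.mp hg).sum_comp
        (fun j => min |hσ.isHermitian.eigenvalues j| δ)] at hsum
    have hr₁ : (hermRank hρ.isHermitian δ : ℝ) * δ ≤ r₁ * δ := by
      gcongr
      exact h₁.1
    have hr₂ : (hermRank hσ.isHermitian δ : ℝ) * δ ≤ r₂ * δ := by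
      gcongr
      exact h₂.1
    linarith [sum_min_abs_eigenvalues_le hρ.isHermitian δ,
      sum_min_abs_eigenvalues_le hσ.isHermitian δ, h₁.2, h₂.2]
end

section
/- Let ρ and σ be N×N positive semidefinite complex matrices and δ ≥ 0. Then rank_δ(ρ − σ) ≤ rank_δ(ρ) + rank_δ(σ). -/
open Finset ComplexOrder

/-- The quadratic form of a Hermitian matrix in coordinates of its eigenvector basis. -/
lemma Matrix.IsHermitian.re_inner_toEuclideanLin {n : Type*} [Fintype n] [DecidableEq n]
    {A : Matrix n n ℂ} (hA : A.IsHermitian) (v : EuclideanSpace ℂ n) :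
    (inner ℂ v (A.toEuclideanLin v)).re
      = ∑ j, hA.eigenvalues j * ‖inner ℂ (hA.eigenvectorBasis j) v‖ ^ 2 := by
  have hsymm := Matrix.isSymmetric_toEuclideanLin_iff.mpr hA
  rw [← hA.eigenvectorBasis.sum_inner_mul_inner, Complex.re_sum]
  refine Finset.sum_congr rfl fun j _ => ?_
  have hb : A.toEuclideanLin (hA.eigenvectorBasis j)
      = (hA.eigenvalues j : ℂ) • hA.eigenvectorBasis j := by
    ext i
    simpa using congrFun (hA.mulVec_eigenvectorBasis j) i
  rw [← hsymm, hb, inner_smul_left, Complex.conj_ofReal, mul_left_comm, Complex.re_ofReal_mul]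
  congr 1
  rw [← inner_conj_symm v, mul_comm, Complex.mul_conj, Complex.ofReal_re,
    Complex.normSq_eq_norm_sq]

/-- If the quadratic form of `ε • A` is bounded by that of `B`, then `ε • A` has at most as many
eigenvalues above `δ` as `B`. -/
lemma card_lt_mul_eigenvalues_le {n : Type*} [Fintype n] [DecidableEq n] {A B : Matrix n n ℂ}
    (hA : A.IsHermitian) (hB : B.IsHermitian) (ε δ : ℝ)
    (h : ∀ v, ε * (inner ℂ v (A.toEuclideanLin v)).re ≤ (inner ℂ v (B.toEuclideanLin v)).re) :
    #{j | δ < ε * hA.eigenvalues j} ≤ #{j | δ < hB.eigenvalues j} := by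
  by_contra! hlt
  let f : EuclideanSpace ℂ n →ₗ[ℂ]
      ({j // ¬ δ < ε * hA.eigenvalues j} → ℂ) × ({j // δ < hB.eigenvalues j} → ℂ) :=
    (LinearMap.pi fun j => innerₛₗ ℂ (hA.eigenvectorBasis j.1)).prod
      (LinearMap.pi fun j => innerₛₗ ℂ (hB.eigenvectorBasis j.1))
  have hf : LinearMap.ker f ≠ ⊥ := by
    apply LinearMap.ker_ne_bot_of_finrank_lt
    have hc := Finset.card_filter_add_card_filter_not (s := (univ : Finset n))
      (fun j => δ < ε * hA.eigenvalues j)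
    rw [Module.finrank_prod, Module.finrank_fintype_fun_eq_card,
      Module.finrank_fintype_fun_eq_card, Fintype.card_subtype, Fintype.card_subtype,
      finrank_euclideanSpace, ← Finset.card_univ]
    omega
  obtain ⟨v, hv, hv0⟩ := Submodule.exists_mem_ne_zero_of_ne_bot hf
  have hfv : f v = 0 := hv
  have hvA : ∀ j, ¬ δ < ε * hA.eigenvalues j → inner ℂ (hA.eigenvectorBasis j) v = 0 :=
    fun j hj => congrFun (congrArg Prod.fst hfv) ⟨j, hj⟩
  have hvB : ∀ j, δ < hB.eigenvalues j → inner ℂ (hB.eigenvectorBasis j) v = 0 :=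
    fun j hj => congrFun (congrArg Prod.snd hfv) ⟨j, hj⟩
  have hlower : δ * ‖v‖ ^ 2 < ε * (inner ℂ v (A.toEuclideanLin v)).re := by
    rw [hA.re_inner_toEuclideanLin, ← hA.eigenvectorBasis.sum_sq_norm_inner_right, mul_sum,
      mul_sum]
    obtain ⟨i, hi⟩ : ∃ i, inner ℂ (hA.eigenvectorBasis i) v ≠ 0 := by
      by_contra! h0
      exact hv0 (InnerProductSpace.ext_inner_left_basis hA.eigenvectorBasis.toBasis (by simpa using h0))
    refine Finset.sum_lt_sum (fun j _ => ?_) ⟨i, mem_univ i, ?_⟩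
    · by_cases hj : δ < ε * hA.eigenvalues j
      · rw [← mul_assoc]
        gcongr
      · simp [hvA j hj]
    · have hi' : δ < ε * hA.eigenvalues i := not_not.mp fun hn => hi (hvA i hn)
      rw [← mul_assoc]
      gcongr
  have hupper : (inner ℂ v (B.toEuclideanLin v)).re ≤ δ * ‖v‖ ^ 2 := by
    rw [hB.re_inner_toEuclideanLin, ← hB.eigenvectorBasis.sum_sq_norm_inner_right, mul_sum]
    refine Finset.sum_le_sum fun j _ => ?_
    by_cases hj : δ < hB.eigenvalues j
    · simp [hvB j hj]
    · gcongr
      exact not_lt.mp hj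
  linarith [h v]

lemma Matrix.PosSemidef.re_inner_toEuclideanLin_nonneg {n : Type*} [Fintype n] [DecidableEq n]
    {A : Matrix n n ℂ} (hA : A.PosSemidef) (v : EuclideanSpace ℂ n) :
    0 ≤ (inner ℂ v (A.toEuclideanLin v)).re := by
  rw [hA.isHermitian.re_inner_toEuclideanLin]
  exact Finset.sum_nonneg fun j _ => mul_nonneg (hA.eigenvalues_nonneg j) (sq_nonneg _)

theorem approxRank_sub_le {N : ℕ} (ρ σ : Matrix (Fin N) (Fin N) ℂ)
    (hρ : ρ.PosSemidef) (hσ : σ.PosSemidef) (δ : ℝ) (hδ : 0 ≤ δ) :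
    hermRank (hρ.isHermitian.sub hσ.isHermitian) δ
      ≤ hermRank hρ.isHermitian δ + hermRank hσ.isHermitian δ := by
  have hform : ∀ v : EuclideanSpace ℂ (Fin N), (inner ℂ v ((ρ - σ).toEuclideanLin v)).re
      = (inner ℂ v (ρ.toEuclideanLin v)).re - (inner ℂ v (σ.toEuclideanLin v)).re := fun v => by
    rw [map_sub, LinearMap.sub_apply, inner_sub_right, Complex.sub_re]
  have hpos := card_lt_mul_eigenvalues_le (hρ.isHermitian.sub hσ.isHermitian) hρ.isHermitian 1 δ
    fun v => by linarith [hform v, hσ.re_inner_toEuclideanLin_nonneg v]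
  have hneg := card_lt_mul_eigenvalues_le (hρ.isHermitian.sub hσ.isHermitian) hσ.isHermitian (-1) δ
    fun v => by linarith [hform v, hρ.re_inner_toEuclideanLin_nonneg v]
  simp only [hermRank, lt_abs, filter_or]
  refine (card_union_le _ _).trans (add_le_add ?_ ?_)
  · simp only [one_mul] at hpos
    exact hpos.trans (card_le_card subset_union_left)
  · simp only [neg_one_mul] at hneg
    exact hneg.trans (card_le_card subset_union_left)
end

section
/- Let ρ be an N×N density matrix with rank(ρ) ≤ r, let 0 ≤ λ ≤ 1, and let E(ρ) = (1 − λ)ρ + (λ/N)·I be the output of the depolarizing channel with parameter λ. Then for every δ ≥ λ/N: rank_δ(E(ρ)) ≤ r and w(E(ρ), δ) ≤ (λ/N)(N − r) + rδ. -/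
open Finset ComplexOrder

/-- The number of eigenvalues of a Hermitian matrix `A` different from `c` is the rank of
`A - c • 1`. -/
theorem Matrix.IsHermitian.card_eigenvalues_ne {n : Type*} [Fintype n] [DecidableEq n]
    {A : Matrix n n ℂ} (hA : A.IsHermitian) (c : ℝ) :
    (Finset.univ.filter (fun j => hA.eigenvalues j ≠ c)).card =
      (A - (c : ℂ) • (1 : Matrix n n ℂ)).rank := by
  have hdiag : A - (c : ℂ) • (1 : Matrix n n ℂ) =
      Unitary.conjStarAlgAut ℂ _ hA.eigenvectorUnitary
        (Matrix.diagonal fun j => ((hA.eigenvalues j - c : ℝ) : ℂ)) := by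
    have hsub : (Matrix.diagonal fun j => ((hA.eigenvalues j - c : ℝ) : ℂ)) =
        Matrix.diagonal (RCLike.ofReal ∘ hA.eigenvalues) - (c : ℂ) • (1 : Matrix n n ℂ) := by
      ext i j
      by_cases h : i = j
      · subst h; simp
      · simp [h]
    rw [hsub, map_sub, map_smul, map_one, ← hA.spectral_theorem]
  rw [hdiag, Unitary.conjStarAlgAut_apply, ← Unitary.coe_star,
    Matrix.rank_mul_eq_left_of_isUnit_det, Matrix.rank_mul_eq_right_of_isUnit_det,
    Matrix.rank_diagonal, Fintype.card_subtype]
  · congr 1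
    ext j
    simp [sub_eq_zero]
  · exact Matrix.UnitaryGroup.det_isUnit _
  · exact Matrix.UnitaryGroup.det_isUnit _

theorem depolarized_approx_low_rank {N : ℕ} (ρ : Matrix (Fin N) (Fin N) ℂ)
    (hρ : ρ.PosSemidef) (hρtr : ρ.trace = 1)
    (r : ℕ) (hrank : ρ.rank ≤ r)
    (lam : ℝ) (hlam : lam ∈ Set.Icc (0 : ℝ) 1)
    (E : Matrix (Fin N) (Fin N) ℂ)
    (hE : E = ((1 - lam : ℝ) : ℂ) • ρ + ((lam / N : ℝ) : ℂ) • (1 : Matrix (Fin N) (Fin N) ℂ))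
    (hEH : E.IsHermitian)
    (δ : ℝ) (hδ : lam / N ≤ δ) :
    hermRank hEH δ ≤ r ∧
    hermW hEH δ ≤ (lam / N) * ((N : ℝ) - r) + r * δ := by
  have hc : 0 ≤ lam / N := div_nonneg hlam.1 (Nat.cast_nonneg N)
  set c : ℝ := lam / N
  have hcard : (Finset.univ.filter (fun j => hEH.eigenvalues j ≠ c)).card ≤ r := by
    rw [hEH.card_eigenvalues_ne c]
    have hsub : E - (c : ℂ) • (1 : Matrix (Fin N) (Fin N) ℂ) =
        (((1 - lam : ℝ) : ℂ) • (1 : Matrix (Fin N) (Fin N) ℂ)) * ρ := by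
      rw [hE, add_sub_cancel_right, Matrix.smul_mul, Matrix.one_mul]
    rw [hsub]
    exact (Matrix.rank_mul_le_right _ _).trans hrank
  constructor
  · refine (Finset.card_le_card fun j hj => ?_).trans hcard
    simp only [Finset.mem_filter, Finset.mem_univ, true_and] at hj ⊢
    intro h
    rw [h, abs_of_nonneg hc] at hj
    exact hj.not_ge hδ
  · calc hermW hEH δ
        ≤ ∑ j ∈ Finset.univ.filter (fun j => |hEH.eigenvalues j| ≤ δ),
            (c + if hEH.eigenvalues j ≠ c then δ - c else 0) := by
          refine Finset.sum_le_sum fun j hj => ?_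
          split_ifs with h
          · simpa using hj
          · rw [not_not.mp h, abs_of_nonneg hc, add_zero]
      _ ≤ ∑ j, (c + if hEH.eigenvalues j ≠ c then δ - c else 0) := by
          refine Finset.sum_le_sum_of_subset_of_nonneg (Finset.filter_subset _ _) fun j _ _ => ?_
          split_ifs <;> linarith
      _ = N * c + (Finset.univ.filter (fun j => hEH.eigenvalues j ≠ c)).card * (δ - c) := by
          rw [Finset.sum_add_distrib, ← Finset.sum_filter]
          simp [mul_sub]
      _ ≤ N * c + r * (δ - c) := by
          have : 0 ≤ δ - c := sub_nonneg.mpr hδ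
          gcongr
      _ = c * ((N : ℝ) - r) + r * δ := by ring
end
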